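/- arXiv:1409.0564 — 4 statements merged into one kernel-verified Lean document; each statement's English description precedes it below -/
import Mathlib

section
/- Fix real numbers p, q, s with p, q nonzero and s > 0. The following are equivalent: (1) for every n and every n×n complex matrix K, the map (A,B) ↦ Ψ_{K,p,q,s}(A,B) is jointly convex on pairs of n×n positive definite matrices; (2) the same holds for every n and every unitary K; (3) for every n, the map (A,B) ↦ Φ_{p,q,s}(A,B) = Ψ_{𝟙,p,q,s}(A,B) is jointly convex; (4) for every n and every matrix K, the map A ↦ Ψ_{K,p,q,s}(A,A) is convex on positive definite matrices; (5) the same as (4) for every unitary K. -/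
open Matrix
open scoped ComplexOrder

/-- Real power of a matrix, defined via the spectral decomposition when the matrix is
Hermitian (junk value `0` otherwise). For a positive (semi-)definite matrix this is the
usual real power given by the spectral functional calculus (with `0 ^ r = 0`). -/
noncomputable def mpow {n : ℕ} (A : Matrix (Fin n) (Fin n) ℂ) (r : ℝ) :
    Matrix (Fin n) (Fin n) ℂ :=
  if h : A.IsHermitian then
    (h.eigenvectorUnitary : Matrix (Fin n) (Fin n) ℂ) *
      Matrix.diagonal (fun i => ((h.eigenvalues i ^ r : ℝ) : ℂ)) *
      (star h.eigenvectorUnitary : Matrix (Fin n) (Fin n) ℂ)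
  else 0

/-- `Ψ_{K,p,q,s}(A,B) = Tr[(A^{q/2} K* B^p K A^{q/2})^s]`. -/
noncomputable def Psi {n : ℕ} (K : Matrix (Fin n) (Fin n) ℂ) (p q s : ℝ)
    (A B : Matrix (Fin n) (Fin n) ℂ) : ℝ :=
  (Matrix.trace (mpow (mpow A (q / 2) * Kᴴ * mpow B p * K * mpow A (q / 2)) s)).re

/-- `Φ_{p,q,s}(A,B) = Tr[(A^{q/2} B^p A^{q/2})^s]`. -/
noncomputable def Phi {n : ℕ} (p q s : ℝ) (A B : Matrix (Fin n) (Fin n) ℂ) : ℝ :=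
  (Matrix.trace (mpow (mpow A (q / 2) * mpow B p * mpow A (q / 2)) s)).re

/-- Joint convexity of a real-valued function of two positive definite matrices. -/
def JointlyConvex {n : ℕ}
    (f : Matrix (Fin n) (Fin n) ℂ → Matrix (Fin n) (Fin n) ℂ → ℝ) : Prop :=
  ∀ A₁ A₂ B₁ B₂ : Matrix (Fin n) (Fin n) ℂ,
    A₁.PosDef → A₂.PosDef → B₁.PosDef → B₂.PosDef →
    ∀ t : ℝ, 0 ≤ t → t ≤ 1 →
      f (t • A₁ + (1 - t) • A₂) (t • B₁ + (1 - t) • B₂) ≤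
        t * f A₁ B₁ + (1 - t) * f A₂ B₂

/-- Convexity of a real-valued function of one positive definite matrix. -/
def ConvexOnPD {n : ℕ} (f : Matrix (Fin n) (Fin n) ℂ → ℝ) : Prop :=
  ∀ A₁ A₂ : Matrix (Fin n) (Fin n) ℂ, A₁.PosDef → A₂.PosDef →
    ∀ t : ℝ, 0 ≤ t → t ≤ 1 →
      f (t • A₁ + (1 - t) • A₂) ≤ t * f A₁ + (1 - t) * f A₂


namespace Matrix

theorem PosDef.fromBlocks_diag {ι κ : Type*} [Fintype ι] [Fintype κ]
    {A : Matrix ι ι ℂ} {D : Matrix κ κ ℂ} (hA : A.PosDef)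
    (hD : D.PosDef) : (fromBlocks A 0 0 D).PosDef := by
  refine .of_dotProduct_mulVec_pos (hA.isHermitian.fromBlocks (by simp) hD.isHermitian) ?_
  intro x hx
  have key : star x ⬝ᵥ (fromBlocks A 0 0 D *ᵥ x) =
      star (x ∘ Sum.inl) ⬝ᵥ (A *ᵥ (x ∘ Sum.inl)) +
        star (x ∘ Sum.inr) ⬝ᵥ (D *ᵥ (x ∘ Sum.inr)) := by
    simp [fromBlocks_mulVec, dotProduct]
  rw [key]
  by_cases h : x ∘ Sum.inl = 0
  · have h' : x ∘ Sum.inr ≠ 0 := by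
      rintro h'
      exact hx (funext fun i => by
        rcases i with i | i
        · exact congrFun h i
        · exact congrFun h' i)
    exact add_pos_of_nonneg_of_pos (hA.posSemidef.dotProduct_mulVec_nonneg _)
      (hD.dotProduct_mulVec_pos h')
  · exact add_pos_of_pos_of_nonneg (hA.dotProduct_mulVec_pos h)
      (hD.posSemidef.dotProduct_mulVec_nonneg _)

theorem trace_fromBlocks_diag {ι κ : Type*} [Fintype ι] [Fintype κ] (A : Matrix ι ι ℂ)
    (D : Matrix κ κ ℂ) :
    trace (fromBlocks A 0 0 D) = trace A + trace D := by
  simp [trace]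

variable {ι κ : Type*} [Fintype ι] [DecidableEq ι] [Fintype κ] [DecidableEq κ]

/-- Real power of a Hermitian matrix over an arbitrary finite index type. -/
noncomputable def realPow (A : Matrix ι ι ℂ) (r : ℝ) : Matrix ι ι ℂ :=
  cfc (fun x : ℝ => x ^ r) A

/-- `Tr[(A^{q/2} K* B^p K A^{q/2})^s]` over an arbitrary finite index type. -/
noncomputable def tracePsi (K : Matrix ι ι ℂ) (p q s : ℝ) (A B : Matrix ι ι ℂ) : ℝ :=
  (trace (realPow (realPow A (q / 2) * Kᴴ * realPow B p * K * realPow A (q / 2)) s)).re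

theorem continuousOn_real_spectrum (f : ℝ → ℝ) (A : Matrix ι ι ℂ) :
    ContinuousOn f (spectrum ℝ A) :=
  A.finite_real_spectrum.continuousOn f

theorem isHermitian_realPow (A : Matrix ι ι ℂ) (r : ℝ) : (realPow A r).IsHermitian :=
  cfc_predicate (p := IsSelfAdjoint) (fun x : ℝ => x ^ r) A

theorem exists_polynomial_eqOn (f : ℝ → ℝ) {S : Set ℝ} (hS : S.Finite) :
    ∃ P : Polynomial ℝ, S.EqOn f P.eval := by
  refine ⟨Lagrange.interpolate hS.toFinset id f, fun x hx => ?_⟩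
  exact (Lagrange.eval_interpolate_at_node (v := id) f (Set.injOn_id _)
    (hS.mem_toFinset.2 hx)).symm

theorem cfc_eq_aeval {f : ℝ → ℝ} {S : Set ℝ} {P : Polynomial ℝ} (hP : S.EqOn f P.eval)
    {A : Matrix ι ι ℂ} (hA : A.IsHermitian) (hS : spectrum ℝ A ⊆ S) :
    cfc f A = Polynomial.aeval A P := by
  rw [← cfc_polynomial _ A hA.isSelfAdjoint]
  exact cfc_congr (hP.mono hS)

theorem map_realPow (φ : Matrix ι ι ℂ →ₐ[ℝ] Matrix κ κ ℂ) {A : Matrix ι ι ℂ}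
    (hA : A.IsHermitian) (hφA : (φ A).IsHermitian) (r : ℝ) :
    φ (realPow A r) = realPow (φ A) r := by
  obtain ⟨P, hP⟩ := exists_polynomial_eqOn (fun x : ℝ => x ^ r) A.finite_real_spectrum
  rw [realPow, realPow, cfc_eq_aeval hP hA le_rfl, cfc_eq_aeval hP hφA (AlgHom.spectrum_apply_subset φ A),
    Polynomial.aeval_algHom_apply]

theorem aeval_fromBlocks_diag (A : Matrix ι ι ℂ) (D : Matrix κ κ ℂ) (P : Polynomial ℝ) :
    Polynomial.aeval (fromBlocks A 0 0 D) P =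
      fromBlocks (Polynomial.aeval A P) 0 0 (Polynomial.aeval D P) := by
  have hpow (n : ℕ) : fromBlocks A 0 0 D ^ n = fromBlocks (A ^ n) 0 0 (D ^ n) := by
    induction n with
    | zero => simp
    | succ n ih => simp [pow_succ, ih, fromBlocks_multiply]
  induction P using Polynomial.induction_on' with
  | add P Q hP hQ => simp [hP, hQ, fromBlocks_add]
  | monomial n a =>
    simp [Polynomial.aeval_monomial, hpow, Algebra.algebraMap_eq_smul_one, fromBlocks_smul]

theorem realPow_fromBlocks_diag {A : Matrix ι ι ℂ} {D : Matrix κ κ ℂ} (hA : A.IsHermitian)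
    (hD : D.IsHermitian) (r : ℝ) :
    realPow (fromBlocks A 0 0 D) r = fromBlocks (realPow A r) 0 0 (realPow D r) := by
  have hAD : (fromBlocks A 0 0 D).IsHermitian := hA.fromBlocks (by simp) hD
  obtain ⟨P, hP⟩ := exists_polynomial_eqOn (fun x : ℝ => x ^ r)
    (A.finite_real_spectrum.union (D.finite_real_spectrum.union (fromBlocks A 0 0 D).finite_real_spectrum))
  simp only [realPow]
  rw [cfc_eq_aeval hP hA (fun x hx => .inl hx), cfc_eq_aeval hP hD (fun x hx => .inr (.inl hx)),
    cfc_eq_aeval hP hAD (fun x hx => .inr (.inr hx)),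
    aeval_fromBlocks_diag]

theorem realPow_smul_one {c : ℝ} (r : ℝ) :
    realPow (c • (1 : Matrix ι ι ℂ)) r = c ^ r • (1 : Matrix ι ι ℂ) := by
  have := cfc_algebraMap (A := Matrix ι ι ℂ) (p := IsSelfAdjoint) c (fun x : ℝ => x ^ r)
  simpa only [realPow, Algebra.algebraMap_eq_smul_one] using this

theorem realPow_zero_left {r : ℝ} (hr : r ≠ 0) : realPow (0 : Matrix ι ι ℂ) r = 0 := by
  have := realPow_smul_one (ι := ι) (c := 0) r
  simpa [Real.zero_rpow hr] using this

theorem realPow_smul {A : Matrix ι ι ℂ} (hA : A.PosSemidef) {c : ℝ} (hc : 0 ≤ c) (r : ℝ) :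
    realPow (c • A) r = c ^ r • realPow A r := by
  have hA' : IsSelfAdjoint A := hA.isHermitian
  rw [realPow, realPow, ← cfc_const_mul_id c A, ← cfc_comp' _ _ _
    (((A.finite_real_spectrum.image _)).continuousOn _) ,
    ← cfc_smul _ _ _ (continuousOn_real_spectrum _ A)]
  refine cfc_congr fun x hx => ?_
  obtain ⟨i, rfl⟩ := hA.isHermitian.spectrum_real_eq_range_eigenvalues ▸ hx
  simp [Real.mul_rpow hc (hA.eigenvalues_nonneg i)]

open scoped Matrix.Norms.L2Operator in
theorem tendsto_trace_realPow {M : ℝ → Matrix ι ι ℂ} (hM : Continuous M)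
    (hherm : ∀ x, (M x).IsHermitian) {s : ℝ} (hs : 0 < s) :
    Filter.Tendsto (fun x => (trace (realPow (M x) s)).re) (nhdsWithin 0 (Set.Ioi 0))
      (nhds (trace (realPow (M 0) s)).re) := by
  have h : Continuous fun x => cfc (fun y : ℝ => y ^ s) (M x) :=
    hM.cfc_of_mem_nhdsSet (s := Set.univ) _ Filter.univ_mem hherm
      (Real.continuous_rpow_const hs.le).continuousOn
  have h' : Continuous fun x => (trace (realPow (M x) s)).re :=
    Complex.continuous_re.comp (Continuous.matrix_trace h)
  exact h'.continuousAt.tendsto.mono_left nhdsWithin_le_nhds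

theorem isHermitian_conj_realPow (K A B : Matrix ι ι ℂ) (p q : ℝ) :
    (realPow A q * Kᴴ * realPow B p * K * realPow A q).IsHermitian := by
  have hA := (isHermitian_realPow A q).eq
  have hB := (isHermitian_realPow B p).eq
  simp [IsHermitian, conjTranspose_mul, hA, hB, mul_assoc]

theorem tracePsi_reindex (e : ι ≃ κ) {K A B : Matrix ι ι ℂ} (hA : A.IsHermitian)
    (hB : B.IsHermitian) (p q s : ℝ) :
    tracePsi (reindexAlgEquiv ℝ ℂ e K) p q s (reindexAlgEquiv ℝ ℂ e A)
      (reindexAlgEquiv ℝ ℂ e B) = tracePsi K p q s A B := by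
  have hH {X : Matrix ι ι ℂ} (hX : X.IsHermitian) : (reindexAlgEquiv ℝ ℂ e X).IsHermitian := by
    simpa using hX.submatrix e.symm
  have hpow {X : Matrix ι ι ℂ} (hX : X.IsHermitian) (r : ℝ) :
      realPow (reindexAlgEquiv ℝ ℂ e X) r = reindexAlgEquiv ℝ ℂ e (realPow X r) :=
    (map_realPow (reindexAlgEquiv ℝ ℂ e).toAlgHom hX (hH hX) r).symm
  have hK : (reindexAlgEquiv ℝ ℂ e K)ᴴ = reindexAlgEquiv ℝ ℂ e Kᴴ := by
    simp [conjTranspose_submatrix]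
  rw [tracePsi, tracePsi, hpow hA, hpow hB, hK, ← map_mul, ← map_mul, ← map_mul, ← map_mul,
    hpow (isHermitian_conj_realPow K A B p (q / 2))]
  congr 1
  exact Fintype.sum_equiv e.symm _ _ fun i => rfl

theorem realPow_conj {U B : Matrix ι ι ℂ} (hU : U ∈ unitaryGroup ι ℂ) (hB : B.IsHermitian)
    (r : ℝ) : realPow (Uᴴ * B * U) r = Uᴴ * realPow B r * U := by
  have h := map_realPow
    (Unitary.conjStarAlgAut ℝ _ (star ⟨U, hU⟩ : unitaryGroup ι ℂ)).toAlgEquiv.toAlgHom hB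
    (by simpa [star_eq_conjTranspose] using isHermitian_conjTranspose_mul_mul U hB) r
  simpa [star_eq_conjTranspose] using h.symm

theorem tracePsi_conj {U A B : Matrix ι ι ℂ} (hU : U ∈ unitaryGroup ι ℂ)
    (hB : B.IsHermitian) (p q s : ℝ) :
    tracePsi 1 p q s A (Uᴴ * B * U) = tracePsi U p q s A B := by
  rw [tracePsi, tracePsi, realPow_conj hU hB]
  simp only [conjTranspose_one, mul_one, mul_assoc]

theorem tracePsi_fromBlocks_diag {P Q A B C D : Matrix ι ι ℂ} (hA : A.IsHermitian)
    (hB : B.IsHermitian) (hC : C.IsHermitian) (hD : D.IsHermitian) (p q s : ℝ) :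
    tracePsi (fromBlocks P 0 0 Q) p q s (fromBlocks A 0 0 B) (fromBlocks C 0 0 D) =
      tracePsi P p q s A C + tracePsi Q p q s B D := by
  simp [tracePsi, realPow_fromBlocks_diag, hA, hB, hC, hD, fromBlocks_conjTranspose,
    fromBlocks_multiply, isHermitian_conj_realPow, trace_fromBlocks_diag]

theorem tracePsi_fromBlocks_antidiag {P Q A B C D : Matrix ι ι ℂ} (hA : A.IsHermitian)
    (hB : B.IsHermitian) (hC : C.IsHermitian) (hD : D.IsHermitian) (p q s : ℝ) :
    tracePsi (fromBlocks 0 P Q 0) p q s (fromBlocks A 0 0 B) (fromBlocks C 0 0 D) =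
      tracePsi Q p q s A D + tracePsi P p q s B C := by
  simp [tracePsi, realPow_fromBlocks_diag, hA, hB, hC, hD, fromBlocks_conjTranspose,
    fromBlocks_multiply, isHermitian_conj_realPow, trace_fromBlocks_diag]

theorem tracePsi_cycle {A B C D : Matrix ι ι ℂ} (hA : A.IsHermitian)
    (hB : B.IsHermitian) (hC : C.IsHermitian) (hD : D.IsHermitian) (p q s : ℝ) :
    tracePsi (fromBlocks 0 (fromBlocks 0 1 1 0) 1 0) p q s
        (fromBlocks (fromBlocks A 0 0 C) 0 0 (fromBlocks B 0 0 D))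
        (fromBlocks (fromBlocks A 0 0 C) 0 0 (fromBlocks B 0 0 D)) =
      tracePsi 1 p q s A B + tracePsi 1 p q s C D +
        (tracePsi 1 p q s B C + tracePsi 1 p q s D A) := by
  have hAC : (fromBlocks A 0 0 C).IsHermitian := hA.fromBlocks (by simp) hC
  have hBD : (fromBlocks B 0 0 D).IsHermitian := hB.fromBlocks (by simp) hD
  rw [tracePsi_fromBlocks_antidiag hAC hBD hAC hBD, tracePsi_fromBlocks_antidiag hB hD hA hC,
    ← fromBlocks_one, tracePsi_fromBlocks_diag hA hC hB hD]

theorem realPow_rpow_smul_one {r x : ℝ} (hr : r ≠ 0) (hx : 0 ≤ x) :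
    realPow (x ^ (1 / r) • (1 : Matrix ι ι ℂ)) r = x • (1 : Matrix ι ι ℂ) := by
  rw [realPow_smul_one, ← Real.rpow_mul hx, one_div_mul_cancel hr, Real.rpow_one]

theorem tendsto_tracePsi_right {p s : ℝ} (hp : p ≠ 0) (hs : 0 < s) (q : ℝ) (K A : Matrix ι ι ℂ) :
    Filter.Tendsto (fun x : ℝ => tracePsi K p q s A (x ^ (1 / p) • 1))
      (nhdsWithin 0 (Set.Ioi 0)) (nhds 0) := by
  have hA := (isHermitian_realPow A (q / 2)).eq
  have h := tendsto_trace_realPow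
    (M := fun x : ℝ => realPow A (q / 2) * Kᴴ * (x • 1) * K * realPow A (q / 2))
    (by fun_prop) (fun x => by simp [IsHermitian, conjTranspose_mul, hA, mul_assoc]) hs
  simp only [zero_smul, mul_zero, zero_mul, realPow_zero_left hs.ne', trace_zero,
    Complex.zero_re] at h
  refine h.congr' ?_
  filter_upwards [self_mem_nhdsWithin] with x hx
  rw [tracePsi, realPow_rpow_smul_one hp (le_of_lt hx)]

theorem tendsto_tracePsi_left {q s : ℝ} (hq : q ≠ 0) (hs : 0 < s) (p : ℝ) (K B : Matrix ι ι ℂ) :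
    Filter.Tendsto (fun x : ℝ => tracePsi K p q s (x ^ (1 / (q / 2)) • 1) B)
      (nhdsWithin 0 (Set.Ioi 0)) (nhds 0) := by
  have hB := (isHermitian_realPow B p).eq
  have h := tendsto_trace_realPow
    (M := fun x : ℝ => (x • 1) * Kᴴ * realPow B p * K * (x • 1))
    (by fun_prop) (fun x => by simp [IsHermitian, conjTranspose_mul, hB, mul_assoc]) hs
  simp only [zero_smul, mul_zero, realPow_zero_left hs.ne', trace_zero,
    Complex.zero_re] at h
  refine h.congr' ?_
  filter_upwards [self_mem_nhdsWithin] with x hx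
  rw [tracePsi, realPow_rpow_smul_one (div_ne_zero hq two_ne_zero) (le_of_lt hx)]

theorem tendsto_tracePsi_dilation {p q s : ℝ} (hp : p ≠ 0) (hq : q ≠ 0) (hs : 0 < s)
    {A B : Matrix ι ι ℂ} (hA : A.IsHermitian) (hB : B.IsHermitian) (L S T R : Matrix ι ι ℂ) :
    Filter.Tendsto (fun x : ℝ => tracePsi (fromBlocks L T S R) p q s
        (fromBlocks A 0 0 (x ^ (1 / (q / 2)) • (1 : Matrix ι ι ℂ)))
        (fromBlocks B 0 0 (x ^ (1 / p) • (1 : Matrix ι ι ℂ))))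
      (nhdsWithin 0 (Set.Ioi 0)) (nhds (tracePsi L p q s A B)) := by
  have hA' := isHermitian_realPow A (q / 2)
  have hB' := isHermitian_realPow B p
  have hsm (x : ℝ) : (x • (1 : Matrix ι ι ℂ)).IsHermitian := by simp [IsHermitian]
  set F : ℝ → Matrix (ι ⊕ ι) (ι ⊕ ι) ℂ := fun x => fromBlocks (realPow A (q / 2)) 0 0 (x • 1)
  set G : ℝ → Matrix (ι ⊕ ι) (ι ⊕ ι) ℂ := fun x => fromBlocks (realPow B p) 0 0 (x • 1)
  have hF (x : ℝ) : (F x)ᴴ = F x := hA'.fromBlocks (by simp) (hsm x)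
  have hG (x : ℝ) : (G x)ᴴ = G x := hB'.fromBlocks (by simp) (hsm x)
  have hFc : Continuous F := by fun_prop
  have hGc : Continuous G := by fun_prop
  have h := tendsto_trace_realPow
    (M := fun x : ℝ => F x * (fromBlocks L T S R)ᴴ * G x * fromBlocks L T S R * F x)
    (by fun_prop) (fun x => by simp [IsHermitian, conjTranspose_mul, hF, hG, mul_assoc]) hs
  have h0 : (trace (realPow (F 0 * (fromBlocks L T S R)ᴴ * G 0 * fromBlocks L T S R * F 0) s)).re
      = tracePsi L p q s A B := by
    simp [F, G, fromBlocks_conjTranspose, fromBlocks_multiply, realPow_fromBlocks_diag,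
      isHermitian_conj_realPow, trace_fromBlocks_diag, realPow_zero_left hs.ne', tracePsi]
  rw [h0] at h
  refine h.congr' ?_
  filter_upwards [self_mem_nhdsWithin] with x hx
  have hx' : 0 ≤ x := le_of_lt hx
  rw [tracePsi, realPow_fromBlocks_diag hA (hsm _), realPow_fromBlocks_diag hB (hsm _),
    realPow_rpow_smul_one hp hx', realPow_rpow_smul_one (div_ne_zero hq two_ne_zero) hx']

theorem mul_aeval_conjTranspose_mul_self (K : Matrix ι ι ℂ) (P : Polynomial ℝ) :
    K * Polynomial.aeval (Kᴴ * K) P = Polynomial.aeval (K * Kᴴ) P * K := by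
  have hpow (n : ℕ) : K * (Kᴴ * K) ^ n = (K * Kᴴ) ^ n * K := by
    induction n with
    | zero => simp
    | succ n ih => rw [pow_succ, ← mul_assoc, ih, pow_succ]; simp only [mul_assoc]
  induction P using Polynomial.induction_on' with
  | add P Q hP hQ => simp only [map_add, mul_add, add_mul, hP, hQ]
  | monomial n a => simp [Polynomial.aeval_monomial, Algebra.algebraMap_eq_smul_one, hpow]

theorem mul_cfc_conjTranspose_mul_self (K : Matrix ι ι ℂ) (f : ℝ → ℝ) :
    K * cfc f (Kᴴ * K) = cfc f (K * Kᴴ) * K := by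
  obtain ⟨P, hP⟩ := exists_polynomial_eqOn f
    ((Kᴴ * K).finite_real_spectrum.union (K * Kᴴ).finite_real_spectrum)
  rw [cfc_eq_aeval hP (isHermitian_conjTranspose_mul_self K) Set.subset_union_left,
    cfc_eq_aeval hP (isHermitian_mul_conjTranspose_self K) Set.subset_union_right]
  exact mul_aeval_conjTranspose_mul_self K P

theorem exists_unitary_dilation (K : Matrix ι ι ℂ) :
    ∃ r : ℝ, 0 < r ∧ ∃ S T : Matrix ι ι ℂ,
      fromBlocks (r • K) T S (-(r • Kᴴ)) ∈ unitaryGroup (ι ⊕ ι) ℂ := by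
  obtain ⟨R, hR⟩ := ((Kᴴ * K).finite_real_spectrum.union
    (K * Kᴴ).finite_real_spectrum).bddAbove
  have hR0 : 0 < max R 1 := lt_max_of_lt_right one_pos
  set c := max R 1
  set f : ℝ → ℝ := fun x => √(1 - c⁻¹ * x)
  have hsq {A : Matrix ι ι ℂ} (hA : A.IsHermitian)
      (hspec : ∀ x ∈ spectrum ℝ A, x ≤ R) : cfc f A * cfc f A = 1 - c⁻¹ • A := by
    have hA' : IsSelfAdjoint A := hA
    have hf := continuousOn_real_spectrum f A
    rw [← cfc_mul f f A hf hf, ← cfc_const_mul_id c⁻¹ A, ← cfc_one ℝ A,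
      ← cfc_sub _ _ A (continuousOn_real_spectrum _ A) (continuousOn_real_spectrum _ A)]
    refine cfc_congr fun x hx => ?_
    have : c⁻¹ * x ≤ 1 := by
      rw [inv_mul_le_iff₀ hR0, mul_one]
      exact (hspec x hx).trans (le_max_left _ _)
    exact Real.mul_self_sqrt (sub_nonneg.2 this)
  have hS := hsq (isHermitian_conjTranspose_mul_self K) fun x hx => hR (.inl hx)
  have hT := hsq (isHermitian_mul_conjTranspose_self K) fun x hx => hR (.inr hx)
  have hS' : (cfc f (Kᴴ * K))ᴴ = cfc f (Kᴴ * K) := cfc_predicate (p := IsSelfAdjoint) f (Kᴴ * K)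
  have hT' : (cfc f (K * Kᴴ))ᴴ = cfc f (K * Kᴴ) := cfc_predicate (p := IsSelfAdjoint) f (K * Kᴴ)
  have h1 := mul_cfc_conjTranspose_mul_self K f
  have h2 := congrArg conjTranspose h1
  simp only [conjTranspose_mul, hS', hT'] at h2
  obtain ⟨r, hr, hrr⟩ : ∃ r : ℝ, 0 < r ∧ r * r = c⁻¹ :=
    ⟨√c⁻¹, Real.sqrt_pos.2 (inv_pos.2 hR0), Real.mul_self_sqrt (inv_nonneg.2 hR0.le)⟩
  refine ⟨r, hr, cfc f (Kᴴ * K), cfc f (K * Kᴴ), ?_⟩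
  rw [mem_unitaryGroup_iff', star_eq_conjTranspose, fromBlocks_conjTranspose, fromBlocks_multiply,
    ← fromBlocks_one]
  simp [conjTranspose_smul, hS', hT', hS, hT, h1, h2, smul_smul, hrr]

end Matrix

theorem mpow_eq_realPow {n : ℕ} (A : Matrix (Fin n) (Fin n) ℂ) (r : ℝ) :
    mpow A r = realPow A r := by
  by_cases h : A.IsHermitian
  · rw [mpow, dif_pos h, realPow, h.cfc_eq, IsHermitian.cfc, Unitary.conjStarAlgAut_apply]
    rfl
  · rw [mpow, dif_neg h, realPow]
    exact (cfc_apply_of_not_predicate (p := IsSelfAdjoint) A h).symm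

theorem Psi_eq_tracePsi {n : ℕ} (K : Matrix (Fin n) (Fin n) ℂ) (p q s : ℝ) :
    Psi K p q s = tracePsi K p q s := by
  funext A B
  simp only [Psi, tracePsi, mpow_eq_realPow]

theorem Phi_eq_tracePsi_one (n : ℕ) (p q s : ℝ) :
    Phi (n := n) p q s = tracePsi 1 p q s := by
  funext A B
  simp only [Phi, tracePsi, mpow_eq_realPow, conjTranspose_one, mul_one]

namespace Matrix

theorem PosDef.convex_combination {ι : Type*} {A₁ A₂ : Matrix ι ι ℂ} (hA₁ : A₁.PosDef) (hA₂ : A₂.PosDef)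
    {t : ℝ} (ht0 : 0 ≤ t) (ht1 : t ≤ 1) : (t • A₁ + (1 - t) • A₂).PosDef := by
  rcases ht0.eq_or_lt with rfl | ht
  · simpa using hA₂
  rcases ht1.eq_or_lt with rfl | ht'
  · simpa using hA₁
  · exact (hA₁.smul ht).add (hA₂.smul (sub_pos.2 ht'))

theorem convex_combination_self {E : Type*} [AddCommGroup E] [Module ℝ E] (t : ℝ) (x : E) :
    t • x + (1 - t) • x = x := by
  rw [← add_smul, add_sub_cancel, one_smul]

theorem fromBlocks_convex_combination {ι : Type*} (A₁ A₂ D₁ D₂ : Matrix ι ι ℂ) (t : ℝ) :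
    t • fromBlocks A₁ 0 0 D₁ + (1 - t) • fromBlocks A₂ 0 0 D₂ =
      fromBlocks (t • A₁ + (1 - t) • A₂) 0 0 (t • D₁ + (1 - t) • D₂) := by
  simp [fromBlocks_smul, fromBlocks_add]

theorem posDef_smul_one {ι : Type*} [DecidableEq ι] {c : ℝ} (hc : 0 < c) : (c • (1 : Matrix ι ι ℂ)).PosDef :=
  PosDef.one.smul hc

variable {ι : Type*} [Fintype ι] [DecidableEq ι]

theorem tracePsi_convex_of_fin {p q s : ℝ}
    (h : ∀ (n : ℕ) (K : Matrix (Fin n) (Fin n) ℂ),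
      K ∈ unitaryGroup (Fin n) ℂ → ConvexOnPD (fun A => Psi K p q s A A))
    {K : Matrix ι ι ℂ} (hK : K ∈ unitaryGroup ι ℂ) {A₁ A₂ : Matrix ι ι ℂ} (hA₁ : A₁.PosDef)
    (hA₂ : A₂.PosDef) {t : ℝ} (ht0 : 0 ≤ t) (ht1 : t ≤ 1) :
    tracePsi K p q s (t • A₁ + (1 - t) • A₂) (t • A₁ + (1 - t) • A₂) ≤
      t * tracePsi K p q s A₁ A₁ + (1 - t) * tracePsi K p q s A₂ A₂ := by
  have e := Fintype.equivFin ι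
  have hpd {X : Matrix ι ι ℂ} (hX : X.PosDef) : (reindexAlgEquiv ℝ ℂ e X).PosDef :=
    hX.submatrix e.symm.injective
  have hK' : reindexAlgEquiv ℝ ℂ e K ∈ unitaryGroup (Fin (Fintype.card ι)) ℂ := by
    rw [mem_unitaryGroup_iff, star_eq_conjTranspose] at hK ⊢
    simpa [conjTranspose_submatrix] using congrArg (reindexAlgEquiv ℝ ℂ e) hK
  have h1 := h _ _ hK' _ _ (hpd hA₁) (hpd hA₂) t ht0 ht1
  have hA := (hA₁.convex_combination hA₂ ht0 ht1).isHermitian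
  rw [Psi_eq_tracePsi, ← map_smul, ← map_smul, ← map_add] at h1
  beta_reduce at h1
  rwa [tracePsi_reindex e hA hA, tracePsi_reindex e hA₁.isHermitian hA₁.isHermitian,
    tracePsi_reindex e hA₂.isHermitian hA₂.isHermitian] at h1

theorem tracePsi_one_convex_of_fin {p q s : ℝ}
    (h : ∀ n : ℕ, JointlyConvex (Phi (n := n) p q s))
    {A₁ A₂ B₁ B₂ : Matrix ι ι ℂ} (hA₁ : A₁.PosDef) (hA₂ : A₂.PosDef) (hB₁ : B₁.PosDef)
    (hB₂ : B₂.PosDef) {t : ℝ} (ht0 : 0 ≤ t) (ht1 : t ≤ 1) :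
    tracePsi 1 p q s (t • A₁ + (1 - t) • A₂) (t • B₁ + (1 - t) • B₂) ≤
      t * tracePsi 1 p q s A₁ B₁ + (1 - t) * tracePsi 1 p q s A₂ B₂ := by
  have e := Fintype.equivFin ι
  have hpd {X : Matrix ι ι ℂ} (hX : X.PosDef) : (reindexAlgEquiv ℝ ℂ e X).PosDef :=
    hX.submatrix e.symm.injective
  have h1 := h _ _ _ _ _ (hpd hA₁) (hpd hA₂) (hpd hB₁) (hpd hB₂) t ht0 ht1
  have hA := (hA₁.convex_combination hA₂ ht0 ht1).isHermitian
  have hB := (hB₁.convex_combination hB₂ ht0 ht1).isHermitian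
  rw [Phi_eq_tracePsi_one] at h1
  simp only [← map_smul, ← map_add] at h1
  rw [← map_one (reindexAlgEquiv ℝ ℂ e)] at h1
  rwa [tracePsi_reindex e hA hB, tracePsi_reindex e hA₁.isHermitian hB₁.isHermitian,
    tracePsi_reindex e hA₂.isHermitian hB₂.isHermitian] at h1

theorem cycle_mem_unitaryGroup :
    (fromBlocks 0 (fromBlocks 0 1 1 0) 1 0 : Matrix ((ι ⊕ ι) ⊕ (ι ⊕ ι)) ((ι ⊕ ι) ⊕ (ι ⊕ ι)) ℂ) ∈
      unitaryGroup ((ι ⊕ ι) ⊕ (ι ⊕ ι)) ℂ := by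
  rw [mem_unitaryGroup_iff, star_eq_conjTranspose]
  simp [fromBlocks_conjTranspose, fromBlocks_multiply]

theorem jointlyConvex_Phi_of_unitary {p q s : ℝ} (hp : p ≠ 0) (hq : q ≠ 0) (hs : 0 < s)
    (h : ∀ (n : ℕ) (K : Matrix (Fin n) (Fin n) ℂ),
      K ∈ unitaryGroup (Fin n) ℂ → ConvexOnPD (fun A => Psi K p q s A A)) (n : ℕ) :
    JointlyConvex (Phi (n := n) p q s) := by
  intro A₁ A₂ B₁ B₂ hA₁ hA₂ hB₁ hB₂ t ht0 ht1
  rw [Phi_eq_tracePsi_one]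
  have hA := (hA₁.convex_combination hA₂ ht0 ht1).isHermitian
  have hB := (hB₁.convex_combination hB₂ ht0 ht1).isHermitian
  set A := t • A₁ + (1 - t) • A₂ with hAdef
  set B := t • B₁ + (1 - t) • B₂ with hBdef
  have hlim (X Y : Matrix (Fin n) (Fin n) ℂ) :
      Filter.Tendsto (fun x : ℝ => tracePsi 1 p q s X Y +
        (tracePsi 1 p q s Y (x ^ (1 / p) • 1) + tracePsi 1 p q s (x ^ (1 / (q / 2)) • 1) X))
        (nhdsWithin 0 (Set.Ioi 0)) (nhds (tracePsi 1 p q s X Y)) := by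
    simpa using tendsto_const_nhds.add
      ((tendsto_tracePsi_right hp hs q 1 Y).add (tendsto_tracePsi_left hq hs p 1 X))
  refine le_of_tendsto_of_tendsto (hlim A B)
    (((hlim A₁ B₁).const_mul t).add ((hlim A₂ B₂).const_mul (1 - t))) ?_
  filter_upwards [self_mem_nhdsWithin] with x hx
  have hC : (x ^ (1 / p) • (1 : Matrix (Fin n) (Fin n) ℂ)).PosDef :=
    posDef_smul_one (Real.rpow_pos_of_pos hx _)
  have hD : (x ^ (1 / (q / 2)) • (1 : Matrix (Fin n) (Fin n) ℂ)).PosDef :=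
    posDef_smul_one (Real.rpow_pos_of_pos hx _)
  set C : Matrix (Fin n) (Fin n) ℂ := x ^ (1 / p) • 1
  set D : Matrix (Fin n) (Fin n) ℂ := x ^ (1 / (q / 2)) • 1
  have key := tracePsi_convex_of_fin h cycle_mem_unitaryGroup
    ((hA₁.fromBlocks_diag hC).fromBlocks_diag (hB₁.fromBlocks_diag hD))
    ((hA₂.fromBlocks_diag hC).fromBlocks_diag (hB₂.fromBlocks_diag hD)) ht0 ht1
  rw [fromBlocks_convex_combination, fromBlocks_convex_combination, fromBlocks_convex_combination,
    convex_combination_self, convex_combination_self, ← hAdef, ← hBdef,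
    tracePsi_cycle hA hB hC.isHermitian hD.isHermitian,
    tracePsi_cycle hA₁.isHermitian hB₁.isHermitian hC.isHermitian hD.isHermitian,
    tracePsi_cycle hA₂.isHermitian hB₂.isHermitian hC.isHermitian hD.isHermitian] at key
  linarith

theorem tracePsi_smul_smul {p r : ℝ} (hp : p ≠ 0) (hr : 0 < r) (q s : ℝ) (K A : Matrix ι ι ℂ)
    {B : Matrix ι ι ℂ} (hB : B.PosDef) :
    tracePsi (r • K) p q s A (((r * r)⁻¹ ^ (1 / p)) • B) = tracePsi K p q s A B := by
  have hr' : 0 < (r * r)⁻¹ := by positivity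
  rw [tracePsi, realPow_smul hB.posSemidef (Real.rpow_nonneg hr'.le _), ← Real.rpow_mul hr'.le,
    one_div_mul_cancel hp, Real.rpow_one, tracePsi]
  have : r * (r⁻¹ * r⁻¹ * r) = 1 := by field_simp
  simp [conjTranspose_smul, smul_smul, this]

theorem jointlyConvex_Psi_of_Phi {p q s : ℝ} (hp : p ≠ 0) (hq : q ≠ 0) (hs : 0 < s)
    (h : ∀ n : ℕ, JointlyConvex (Phi (n := n) p q s)) (n : ℕ) (K : Matrix (Fin n) (Fin n) ℂ) :
    JointlyConvex (Psi K p q s) := by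
  intro A₁ A₂ B₁ B₂ hA₁ hA₂ hB₁ hB₂ t ht0 ht1
  obtain ⟨r, hr, S, T, hU⟩ := exists_unitary_dilation K
  have hA := (hA₁.convex_combination hA₂ ht0 ht1).isHermitian
  have hB := hB₁.convex_combination hB₂ ht0 ht1
  have hk : 0 < (r * r)⁻¹ ^ (1 / p) := Real.rpow_pos_of_pos (by positivity) _
  rw [Psi_eq_tracePsi, ← tracePsi_smul_smul hp hr q s K _ hB, ← tracePsi_smul_smul hp hr q s K _ hB₁,
    ← tracePsi_smul_smul hp hr q s K _ hB₂]
  have hB' := hB.smul hk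
  have hB₁' := hB₁.smul hk
  have hB₂' := hB₂.smul hk
  set k := (r * r)⁻¹ ^ (1 / p)
  have hcomb : k • (t • B₁ + (1 - t) • B₂) = t • (k • B₁) + (1 - t) • (k • B₂) := by
    rw [smul_add, smul_comm k, smul_comm k]
  rw [hcomb] at hB' ⊢
  set U := fromBlocks (r • K) T S (-(r • Kᴴ))
  refine le_of_tendsto_of_tendsto
    (tendsto_tracePsi_dilation hp hq hs hA hB'.isHermitian _ S T (-(r • Kᴴ)))
    (((tendsto_tracePsi_dilation hp hq hs hA₁.isHermitian hB₁'.isHermitian _ S T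
      (-(r • Kᴴ))).const_mul t).add
      ((tendsto_tracePsi_dilation hp hq hs hA₂.isHermitian hB₂'.isHermitian _ S T
        (-(r • Kᴴ))).const_mul (1 - t))) ?_
  filter_upwards [self_mem_nhdsWithin] with x hx
  have hC : (x ^ (1 / p) • (1 : Matrix (Fin n) (Fin n) ℂ)).PosDef :=
    posDef_smul_one (Real.rpow_pos_of_pos hx _)
  have hD : (x ^ (1 / (q / 2)) • (1 : Matrix (Fin n) (Fin n) ℂ)).PosDef :=
    posDef_smul_one (Real.rpow_pos_of_pos hx _)
  have hUpd {X : Matrix (Fin n ⊕ Fin n) (Fin n ⊕ Fin n) ℂ} (hX : X.PosDef) :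
      (Uᴴ * X * U).PosDef :=
    (IsUnit.posDef_star_left_conjugate_iff
      (IsUnit.of_mul_eq_one_right (star U) (mem_unitaryGroup_iff'.1 hU))).2 hX
  have hBC₁ := hB₁'.fromBlocks_diag hC
  have hBC₂ := hB₂'.fromBlocks_diag hC
  have key := tracePsi_one_convex_of_fin h (hA₁.fromBlocks_diag hD) (hA₂.fromBlocks_diag hD)
    (hUpd hBC₁) (hUpd hBC₂) ht0 ht1
  have hlin (X Y : Matrix (Fin n ⊕ Fin n) (Fin n ⊕ Fin n) ℂ) :
      t • (Uᴴ * X * U) + (1 - t) • (Uᴴ * Y * U) = Uᴴ * (t • X + (1 - t) • Y) * U := by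
    simp [mul_add, add_mul]
  rwa [hlin, fromBlocks_convex_combination, fromBlocks_convex_combination,
    convex_combination_self, convex_combination_self,
    tracePsi_conj hU (hB'.fromBlocks_diag hC).isHermitian, tracePsi_conj hU hBC₁.isHermitian,
    tracePsi_conj hU hBC₂.isHermitian] at key

end Matrix

/-- Lemma 1.1 (equivalent formulations), convex case. -/
theorem equiv_formulations_convex (p q s : ℝ) (hp : p ≠ 0) (hq : q ≠ 0) (hs : 0 < s) :
    List.TFAE [
      ∀ (n : ℕ) (K : Matrix (Fin n) (Fin n) ℂ), JointlyConvex (Psi K p q s),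
      ∀ (n : ℕ) (K : Matrix (Fin n) (Fin n) ℂ),
        K ∈ Matrix.unitaryGroup (Fin n) ℂ → JointlyConvex (Psi K p q s),
      ∀ (n : ℕ), JointlyConvex (Phi (n := n) p q s),
      ∀ (n : ℕ) (K : Matrix (Fin n) (Fin n) ℂ), ConvexOnPD (fun A => Psi K p q s A A),
      ∀ (n : ℕ) (K : Matrix (Fin n) (Fin n) ℂ),
        K ∈ Matrix.unitaryGroup (Fin n) ℂ → ConvexOnPD (fun A => Psi K p q s A A)] := by
  tfae_have 1 → 2 := fun h n K _ => h n K
  tfae_have 2 → 3 := fun h n => by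
    rw [Phi_eq_tracePsi_one, ← Psi_eq_tracePsi]
    exact h n 1 (one_mem _)
  tfae_have 3 → 1 := jointlyConvex_Psi_of_Phi hp hq hs
  tfae_have 1 → 4 := fun h n K A₁ A₂ hA₁ hA₂ => h n K A₁ A₂ A₁ A₂ hA₁ hA₂ hA₁ hA₂
  tfae_have 4 → 5 := fun h n K _ => h n K
  tfae_have 5 → 3 := jointlyConvex_Phi_of_unitary hp hq hs
  tfae_finish
end

section
/- Let r ∈ (−∞,0) ∪ (0,1), let n ≥ 2, and let Y be an n×n positive semidefinite complex matrix of rank one. Then the map X ↦ X^r Y X^r from n×n positive definite matrices to matrices is not operator convex; that is, there exist positive definite X₁, X₂ and λ ∈ [0,1] such that (λX₁+(1−λ)X₂)^r Y (λX₁+(1−λ)X₂)^r ≤ λ X₁^r Y X₁^r + (1−λ) X₂^r Y X₂^r fails in the Loewner order. -/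
open Matrix
open scoped ComplexOrder

theorem mpow_mulVec_of_mulVec_eq_smul {n : ℕ} {A : Matrix (Fin n) (Fin n) ℂ}
    (hA : A.IsHermitian) (r x : ℝ) {u : Fin n → ℂ} (hu : A *ᵥ u = (x : ℂ) • u) :
    mpow A r *ᵥ u = ((x ^ r : ℝ) : ℂ) • u := by
  set U : Matrix (Fin n) (Fin n) ℂ := (hA.eigenvectorUnitary : Matrix (Fin n) (Fin n) ℂ) with hU
  have hUU : U * star U = 1 := Unitary.coe_mul_star_self _
  have hUU' : star U * U = 1 := Unitary.coe_star_mul_self _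
  have hsp : A = U * diagonal (fun i => ((hA.eigenvalues i : ℝ) : ℂ)) * star U :=
    hA.spectral_theorem
  have h₁ : diagonal (fun i => ((hA.eigenvalues i : ℝ) : ℂ)) *ᵥ (star U *ᵥ u)
      = (x : ℂ) • (star U *ᵥ u) := by
    rw [← mulVec_smul, ← hu]
    conv_rhs => rw [hsp]
    simp only [mulVec_mulVec, ← Matrix.mul_assoc, hUU', Matrix.one_mul]
  have h₂ : diagonal (fun i => ((hA.eigenvalues i ^ r : ℝ) : ℂ)) *ᵥ (star U *ᵥ u)
      = ((x ^ r : ℝ) : ℂ) • (star U *ᵥ u) := by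
    ext i
    have h := congrFun h₁ i
    simp only [mulVec_diagonal, Pi.smul_apply, smul_eq_mul] at h ⊢
    rcases mul_eq_mul_right_iff.mp h with h | h
    · rw [Complex.ofReal_inj.mp h]
    · rw [h, mul_zero, mul_zero]
  have h₃ : mpow A r = U * diagonal (fun i => ((hA.eigenvalues i ^ r : ℝ) : ℂ)) * star U := by
    rw [mpow, dif_pos hA]
  rw [h₃, ← mulVec_mulVec, ← mulVec_mulVec, h₂, mulVec_smul, mulVec_mulVec, hUU, one_mulVec]

theorem exists_orthonormal_of_posSemidef_rank_eq_one {n : ℕ} (hn : 2 ≤ n)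
    {Y : Matrix (Fin n) (Fin n) ℂ} (hY : Y.PosSemidef) (hrank : Y.rank = 1) :
    ∃ (c : ℝ) (v g : Fin n → ℂ), 0 < c ∧ star v ⬝ᵥ v = 1 ∧ star g ⬝ᵥ g = 1 ∧
      star v ⬝ᵥ g = 0 ∧ star g ⬝ᵥ v = 0 ∧ Y = (c : ℂ) • vecMulVec v (star v) := by
  have hH := hY.isHermitian
  rw [hH.rank_eq_card_non_zero_eigs, Fintype.card_eq_one_iff] at hrank
  obtain ⟨⟨i, hi⟩, huniq⟩ := hrank
  have : Nontrivial (Fin n) := Fin.nontrivial_iff_two_le.mpr hn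
  obtain ⟨j, hj⟩ := exists_ne i
  have hzero : ∀ k, k ≠ i → hH.eigenvalues k = 0 := fun k hk => by
    by_contra h
    exact hk (congrArg Subtype.val (huniq ⟨k, h⟩))
  have horth : ∀ k l, star (hH.eigenvectorBasis k : Fin n → ℂ) ⬝ᵥ
      (hH.eigenvectorBasis l : Fin n → ℂ) = if k = l then 1 else 0 := fun k l => by
    have h := orthonormal_iff_ite.mp hH.eigenvectorBasis.orthonormal k l
    rwa [EuclideanSpace.inner_eq_star_dotProduct, dotProduct_comm] at h
  refine ⟨hH.eigenvalues i, hH.eigenvectorBasis i, hH.eigenvectorBasis j,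
    lt_of_le_of_ne (hY.eigenvalues_nonneg i) (Ne.symm hi), by simp [horth], by simp [horth],
    by simp [horth, hj.symm], by simp [horth, hj], ?_⟩
  have hsp : Y = (hH.eigenvectorUnitary : Matrix (Fin n) (Fin n) ℂ) *
      diagonal (fun k => ((hH.eigenvalues k : ℝ) : ℂ)) *
      star (hH.eigenvectorUnitary : Matrix (Fin n) (Fin n) ℂ) := hH.spectral_theorem
  ext a b
  have h := congrFun (congrFun hsp a) b
  rw [mul_apply, Finset.sum_eq_single i] at h
  · rw [h]
    simp only [mul_diagonal, IsHermitian.eigenvectorUnitary_apply, star_apply, Matrix.smul_apply,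
      vecMulVec_apply, Pi.star_apply, smul_eq_mul]
    ring
  · intro k _ hk
    simp [mul_diagonal, hzero k hk]
  · simp

/-- The matrix with eigenvalues `x` on `e`, `y` on `f` and `1` on the orthogonal complement,
for orthogonal vectors `e`, `f` of squared norm `2`. -/
noncomputable def twoEigen {n : ℕ} (e f : Fin n → ℂ) (x y : ℝ) : Matrix (Fin n) (Fin n) ℂ :=
  1 + ((x : ℂ) - 1) • ((1 / 2 : ℂ) • vecMulVec e (star e)) +
    ((y : ℂ) - 1) • ((1 / 2 : ℂ) • vecMulVec f (star f))

section twoEigen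

variable {n : ℕ} {e f : Fin n → ℂ}

theorem twoEigen_mulVec_left (he : star e ⬝ᵥ e = 2) (hfe : star f ⬝ᵥ e = 0) (x y : ℝ) :
    twoEigen e f x y *ᵥ e = (x : ℂ) • e := by
  simp only [twoEigen, add_mulVec, smul_mulVec, one_mulVec, vecMulVec_mulVec, he, hfe]
  ext i
  simp
  ring

theorem twoEigen_mulVec_right (hf : star f ⬝ᵥ f = 2) (hef : star e ⬝ᵥ f = 0) (x y : ℝ) :
    twoEigen e f x y *ᵥ f = (y : ℂ) • f := by
  simp only [twoEigen, add_mulVec, smul_mulVec, one_mulVec, vecMulVec_mulVec, hf, hef]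
  ext i
  simp
  ring

theorem twoEigen_convexCombination (x₁ y₁ x₂ y₂ t : ℝ) :
    t • twoEigen e f x₁ y₁ + (1 - t) • twoEigen e f x₂ y₂ =
      twoEigen e f (t * x₁ + (1 - t) * x₂) (t * y₁ + (1 - t) * y₂) := by
  ext i j
  simp [twoEigen]
  ring

theorem twoEigen_posDef (he : star e ⬝ᵥ e = 2) (hf : star f ⬝ᵥ f = 2) (hef : star e ⬝ᵥ f = 0)
    (hfe : star f ⬝ᵥ e = 0) {x y : ℝ} (hx : 0 < x) (hy : 0 < y) : (twoEigen e f x y).PosDef := by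
  set P := (1 / 2 : ℂ) • vecMulVec e (star e) with hP
  set Q := (1 / 2 : ℂ) • vecMulVec f (star f) with hQ
  have hhalf : (0 : ℂ) ≤ 1 / 2 := by simp
  have hPs : P.PosSemidef := (posSemidef_vecMulVec_self_star e).smul hhalf
  have hQs : Q.PosSemidef := (posSemidef_vecMulVec_self_star f).smul hhalf
  have hPP : P * P = P := by
    simp [hP, vecMulVec_mul_vecMulVec, he, smul_smul]
  have hQQ : Q * Q = Q := by
    simp [hQ, vecMulVec_mul_vecMulVec, hf, smul_smul]
  have hPQ : P * Q = 0 := by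
    simp [hP, hQ, vecMulVec_mul_vecMulVec, hef]
  have hQP : Q * P = 0 := by
    simp [hP, hQ, vecMulVec_mul_vecMulVec, hfe]
  have hRs : (1 - P - Q).PosSemidef := by
    have h := posSemidef_conjTranspose_mul_self (1 - P - Q)
    have hR : (1 - P - Q)ᴴ * (1 - P - Q) = 1 - P - Q := by
      rw [conjTranspose_sub, conjTranspose_sub, conjTranspose_one, hPs.1.eq, hQs.1.eq]
      simp only [sub_mul, mul_sub, hPP, hQQ, hPQ, hQP, one_mul, mul_one]
      abel
    rwa [hR] at h
  obtain ⟨m, hm, hmx, hmy, hm1⟩ : ∃ m : ℝ, 0 < m ∧ m ≤ x ∧ m ≤ y ∧ m ≤ 1 :=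
    ⟨min x (min y 1), by positivity, min_le_left _ _,
      (min_le_right _ _).trans (min_le_left _ _), (min_le_right _ _).trans (min_le_right _ _)⟩
  have hdec : twoEigen e f x y = ((m : ℝ) : ℂ) • (1 : Matrix (Fin n) (Fin n) ℂ) +
      (((x - m : ℝ) : ℂ) • P + ((y - m : ℝ) : ℂ) • Q + ((1 - m : ℝ) : ℂ) • (1 - P - Q)) := by
    rw [twoEigen, ← hP, ← hQ]
    push_cast
    module
  rw [hdec]
  refine (PosDef.one.smul (by exact_mod_cast hm)).add_posSemidef
    (((hPs.smul ?_).add (hQs.smul ?_)).add (hRs.smul ?_)) <;>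
  · rw [Complex.zero_le_real]
    linarith

theorem quadraticForm_conj_vecMulVec (he : star e ⬝ᵥ e = 2) (hf : star f ⬝ᵥ f = 2)
    (hef : star e ⬝ᵥ f = 0) (hfe : star f ⬝ᵥ e = 0) {S : Matrix (Fin n) (Fin n) ℂ} {a b : ℝ}
    (hSe : S *ᵥ e = (a : ℂ) • e) (hSf : S *ᵥ f = (b : ℂ) • f) (c β : ℝ) :
    star (e + (β : ℂ) • f) ⬝ᵥ ((S * ((c : ℂ) • vecMulVec (e + f) (star (e + f))) * S) *ᵥ
      (e + (β : ℂ) • f)) = ((4 * c * (a + β * b) ^ 2 : ℝ) : ℂ) := by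
  simp only [← mulVec_mulVec, mulVec_add, mulVec_smul, hSe, hSf, smul_mulVec, vecMulVec_mulVec,
    star_add, star_smul, add_dotProduct, dotProduct_add, smul_dotProduct, dotProduct_smul,
    he, hf, hef, hfe, smul_eq_mul, op_smul_eq_smul, smul_add]
  simp
  ring

end twoEigen

theorem exists_rpow_midpoint_lt {r : ℝ} (hr : r < 0 ∨ (0 < r ∧ r < 1)) :
    ∃ x₁ y₁ x₂ y₂ β : ℝ, 0 < x₁ ∧ 0 < y₁ ∧ 0 < x₂ ∧ 0 < y₂ ∧
      1 / 2 * (x₁ ^ r + β * y₁ ^ r) ^ 2 + (1 - 1 / 2) * (x₂ ^ r + β * y₂ ^ r) ^ 2 <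
        ((1 / 2 * x₁ + (1 - 1 / 2) * x₂) ^ r + β * (1 / 2 * y₁ + (1 - 1 / 2) * y₂) ^ r) ^ 2 := by
  rcases hr with hr | ⟨hr₀, hr₁⟩
  · have hq : (0 : ℝ) < 2 ^ (1 / r) := by positivity
    have hq1 : (2 : ℝ) ^ (1 / r) < 1 :=
      Real.rpow_lt_one_of_one_lt_of_neg one_lt_two (by simpa using hr)
    have hqr : ((2 : ℝ) ^ (1 / r)) ^ r = 2 := by
      rw [← Real.rpow_mul two_pos.le, one_div_mul_cancel hr.ne, Real.rpow_one]
    generalize (2 : ℝ) ^ (1 / r) = q at hq hq1 hqr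
    have hδ : 1 < (1 / 2 * 1 + (1 - 1 / 2) * q) ^ r :=
      Real.one_lt_rpow_of_pos_of_lt_one_of_neg (by linarith) (by linarith) hr
    have hlim : Filter.Tendsto (fun z : ℝ => z ^ r) Filter.atTop (nhds 0) := by
      simpa using tendsto_rpow_neg_atTop (neg_pos.mpr hr)
    obtain ⟨z, hz, hz1⟩ := ((hlim.eventually_lt_const (sub_pos.mpr hδ)).and
      (Filter.eventually_gt_atTop 1)).exists
    have hN : (2 * z - 1) ^ r < 1 := Real.rpow_lt_one_of_one_lt_of_neg (by linarith) hr
    have hN0 : 0 < (2 * z - 1) ^ r := Real.rpow_pos_of_pos (by linarith) r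
    refine ⟨1, 2 * z - 1, q, 1, -1, one_pos, by linarith, hq, one_pos, ?_⟩
    have hmid : 1 / 2 * (2 * z - 1) + (1 - 1 / 2) * 1 = z := by ring
    rw [hmid, Real.one_rpow, hqr]
    nlinarith
  · refine ⟨1, 2, 2, 1, 1, one_pos, two_pos, two_pos, one_pos, ?_⟩
    have h := (Real.strictConcaveOn_rpow hr₀ hr₁).2 (Set.mem_Ici.mpr zero_le_one)
      (Set.mem_Ici.mpr zero_le_two) one_lt_two.ne (half_pos one_pos) (half_pos one_pos)
      (add_halves (1 : ℝ))
    simp only [smul_eq_mul, Real.one_rpow] at h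
    have h2 : (0 : ℝ) < 2 ^ r := by positivity
    norm_num [Real.one_rpow] at h ⊢
    nlinarith

/-- Lemma 3.4: for `r ∈ (−∞,0) ∪ (0,1)`, `n ≥ 2` and `Y ≥ 0` of rank one, the map
`X ↦ X^r Y X^r` is not operator convex on positive definite matrices. -/
theorem not_operator_convex_rankOne (r : ℝ) (hr : r < 0 ∨ (0 < r ∧ r < 1))
    (n : ℕ) (hn : 2 ≤ n) (Y : Matrix (Fin n) (Fin n) ℂ) (hY : Y.PosSemidef)
    (hrank : Y.rank = 1) :
    ∃ (X₁ X₂ : Matrix (Fin n) (Fin n) ℂ) (t : ℝ),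
      X₁.PosDef ∧ X₂.PosDef ∧ 0 ≤ t ∧ t ≤ 1 ∧
      ¬ (t • (mpow X₁ r * Y * mpow X₁ r) + (1 - t) • (mpow X₂ r * Y * mpow X₂ r) -
          mpow (t • X₁ + (1 - t) • X₂) r * Y * mpow (t • X₁ + (1 - t) • X₂) r).PosSemidef := by
  obtain ⟨x₁, y₁, x₂, y₂, β, hx₁, hy₁, hx₂, hy₂, hlt⟩ := exists_rpow_midpoint_lt hr
  obtain ⟨c, v, g, hc, hv, hg, hvg, hgv, rfl⟩ :=
    exists_orthonormal_of_posSemidef_rank_eq_one hn hY hrank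
  obtain ⟨e, he_def⟩ : ∃ e, e = v + g := ⟨_, rfl⟩
  obtain ⟨f, hf_def⟩ : ∃ f, f = v - g := ⟨_, rfl⟩
  have he : star e ⬝ᵥ e = 2 := by
    simp [he_def, hv, hg, hvg, hgv]; norm_num
  have hf : star f ⬝ᵥ f = 2 := by
    simp [hf_def, hv, hg, hvg, hgv]; norm_num
  have hef : star e ⬝ᵥ f = 0 := by
    simp [he_def, hf_def, hv, hg, hvg, hgv]
  have hfe : star f ⬝ᵥ e = 0 := by
    simp [he_def, hf_def, hv, hg, hvg, hgv]
  have hY' : (c : ℂ) • vecMulVec v (star v) =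
      ((c / 4 : ℝ) : ℂ) • vecMulVec (e + f) (star (e + f)) := by
    ext i j
    simp [he_def, hf_def, vecMulVec_apply]
    ring
  have hform : ∀ x y : ℝ, 0 < x → 0 < y →
      star (e + (β : ℂ) • f) ⬝ᵥ ((mpow (twoEigen e f x y) r * ((c : ℂ) • vecMulVec v (star v)) *
        mpow (twoEigen e f x y) r) *ᵥ (e + (β : ℂ) • f)) =
        ((c * (x ^ r + β * y ^ r) ^ 2 : ℝ) : ℂ) := fun x y hx hy => by
    have hX := (twoEigen_posDef he hf hef hfe hx hy).isHermitian
    rw [hY', quadraticForm_conj_vecMulVec he hf hef hfe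
      (mpow_mulVec_of_mulVec_eq_smul hX r x (twoEigen_mulVec_left he hfe x y))
      (mpow_mulVec_of_mulVec_eq_smul hX r y (twoEigen_mulVec_right hf hef x y))]
    congr 1
    ring
  refine ⟨twoEigen e f x₁ y₁, twoEigen e f x₂ y₂, 1 / 2, twoEigen_posDef he hf hef hfe hx₁ hy₁,
    twoEigen_posDef he hf hef hfe hx₂ hy₂, by norm_num, by norm_num, fun hpsd => ?_⟩
  have h := hpsd.dotProduct_mulVec_nonneg (e + (β : ℂ) • f)
  rw [twoEigen_convexCombination, sub_mulVec, add_mulVec, smul_mulVec, smul_mulVec,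
    dotProduct_sub, dotProduct_add, dotProduct_smul, dotProduct_smul, hform _ _ hx₁ hy₁,
    hform _ _ hx₂ hy₂, hform _ _ (by linarith) (by linarith), Complex.real_smul,
    Complex.real_smul, ← Complex.ofReal_mul, ← Complex.ofReal_mul, ← Complex.ofReal_add,
    ← Complex.ofReal_sub, Complex.zero_le_real] at h
  nlinarith [mul_lt_mul_of_pos_left hlt hc]
end

section
/- Let p be a real number with −1 ≤ p < 0 and fix n. Then the map (A,B) ↦ A B^p A (i.e., A^{q/2} B^p A^{q/2} with q = 2) is jointly operator convex on pairs of n×n positive definite complex matrices: for all positive definite A₁,A₂,B₁,B₂ and λ ∈ [0,1], (λA₁+(1−λ)A₂)(λB₁+(1−λ)B₂)^p(λA₁+(1−λ)A₂) ≤ λ A₁B₁^pA₁ + (1−λ) A₂B₂^pA₂ in the Loewner order. -/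
open Matrix
open scoped ComplexOrder

open scoped MatrixOrder Matrix.Norms.L2Operator in
/-- On positive semidefinite matrices, `mpow` is the real power of the continuous functional
calculus. -/
theorem mpow_eq_rpow {n : ℕ} {A : Matrix (Fin n) (Fin n) ℂ} (hA : A.PosSemidef) (r : ℝ) :
    mpow A r = A ^ r := by
  rw [CFC.rpow_eq_cfc_real hA.nonneg, hA.isHermitian.cfc_eq, mpow, dif_pos hA.isHermitian]
  rfl

open scoped MatrixOrder Matrix.Norms.L2Operator in
theorem mpow_posSemidef {n : ℕ} {A : Matrix (Fin n) (Fin n) ℂ} (hA : A.PosSemidef) (r : ℝ) :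
    (mpow A r).PosSemidef := by
  rw [mpow_eq_rpow hA, ← nonneg_iff_posSemidef]
  exact CFC.rpow_nonneg

open scoped MatrixOrder Matrix.Norms.L2Operator in
theorem mpow_mul_mpow_neg {n : ℕ} {A : Matrix (Fin n) (Fin n) ℂ} (hA : A.PosDef) (r : ℝ) :
    mpow A r * mpow A (-r) = 1 := by
  rw [mpow_eq_rpow hA.posSemidef, mpow_eq_rpow hA.posSemidef]
  exact CFC.rpow_mul_rpow_neg r hA.isStrictlyPositive

open scoped MatrixOrder Matrix.Norms.L2Operator in
/-- Operator concavity of `mpow` for exponents in `[0, 1]`. -/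
theorem mpow_concave {n : ℕ} {r : ℝ} (hr : r ∈ Set.Icc 0 1) {A B : Matrix (Fin n) (Fin n) ℂ}
    (hA : A.PosSemidef) (hB : B.PosSemidef) {t : ℝ} (ht₀ : 0 ≤ t) (ht₁ : t ≤ 1) :
    (mpow (t • A + (1 - t) • B) r - (t • mpow A r + (1 - t) • mpow B r)).PosSemidef := by
  have hAB : (t • A + (1 - t) • B).PosSemidef :=
    (hA.smul ht₀).add (hB.smul (sub_nonneg.mpr ht₁))
  rw [mpow_eq_rpow hA, mpow_eq_rpow hB, mpow_eq_rpow hAB, ← le_iff]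
  exact (CFC.concaveOn_rpow hr).2 hA.nonneg hB.nonneg ht₀ (sub_nonneg.mpr ht₁) (by ring)

/-- Completing the square: if `M` is positive semidefinite with inverse `C`, then
`A * M * A` dominates `A * X + Xᴴ * A - Xᴴ * C * X` for every `X`. -/
theorem posSemidef_conj_sub_of_mul_eq_one {m : Type*} [Fintype m] [DecidableEq m]
    {A M C : Matrix m m ℂ} (hA : A.IsHermitian) (hM : M.PosSemidef) (hC : C.IsHermitian)
    (hMC : M * C = 1) (X : Matrix m m ℂ) :
    (A * M * A - (A * X + Xᴴ * A - Xᴴ * C * X)).PosSemidef := by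
  have hCM : C * M = 1 := mul_eq_one_comm.mp hMC
  convert hM.conjTranspose_mul_mul_same (A - C * X) using 1
  have hexp : (A - C * X)ᴴ * M * (A - C * X) = A * M * A - A * (M * C) * X
      - Xᴴ * (C * M) * A + Xᴴ * (C * M) * C * X := by
    rw [conjTranspose_sub, conjTranspose_mul, hA.eq, hC.eq]
    noncomm_ring
  rw [hexp, hMC, hCM]
  noncomm_ring

/-- For `−1 ≤ p < 0`, the map `(A,B) ↦ A B^p A` is jointly operator convex. -/
theorem jointly_operator_convex_ABpA (p : ℝ) (hp₁ : -1 ≤ p) (hp₂ : p < 0) (n : ℕ) :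
    ∀ A₁ A₂ B₁ B₂ : Matrix (Fin n) (Fin n) ℂ,
      A₁.PosDef → A₂.PosDef → B₁.PosDef → B₂.PosDef →
      ∀ t : ℝ, 0 ≤ t → t ≤ 1 →
        (t • (A₁ * mpow B₁ p * A₁) + (1 - t) • (A₂ * mpow B₂ p * A₂) -
          (t • A₁ + (1 - t) • A₂) * mpow (t • B₁ + (1 - t) • B₂) p *
            (t • A₁ + (1 - t) • A₂)).PosSemidef := by
  intro A₁ A₂ B₁ B₂ hA₁ hA₂ hB₁ hB₂ t ht₀ ht₁
  have ht₁' : 0 ≤ 1 - t := sub_nonneg.mpr ht₁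
  have hBs : (t • B₁ + (1 - t) • B₂).PosDef := by
    rcases ht₀.eq_or_lt with rfl | ht
    · simpa using hB₂
    · exact (hB₁.smul ht).add_posSemidef (hB₂.posSemidef.smul ht₁')
  have hAs : (t • A₁ + (1 - t) • A₂).IsHermitian :=
    ((hA₁.posSemidef.smul ht₀).add (hA₂.posSemidef.smul ht₁')).isHermitian
  have hconc := mpow_concave (r := -p) ⟨by linarith, by linarith⟩
    hB₁.posSemidef hB₂.posSemidef ht₀ ht₁
  have hMC := mpow_mul_mpow_neg hBs p
  have hM := (mpow_posSemidef hBs.posSemidef p).isHermitian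
  set A := t • A₁ + (1 - t) • A₂
  set M := mpow (t • B₁ + (1 - t) • B₂) p
  set C := mpow (t • B₁ + (1 - t) • B₂) (-p)
  have h₁ := posSemidef_conj_sub_of_mul_eq_one hA₁.isHermitian (mpow_posSemidef hB₁.posSemidef p)
    (mpow_posSemidef hB₁.posSemidef (-p)).isHermitian (mpow_mul_mpow_neg hB₁ p) (M * A)
  have h₂ := posSemidef_conj_sub_of_mul_eq_one hA₂.isHermitian (mpow_posSemidef hB₂.posSemidef p)
    (mpow_posSemidef hB₂.posSemidef (-p)).isHermitian (mpow_mul_mpow_neg hB₂ p) (M * A)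
  convert ((h₁.smul ht₀).add (h₂.smul ht₁')).add (hconc.conjTranspose_mul_mul_same (M * A)) using 1
  have hX : (M * A)ᴴ = A * M := by rw [conjTranspose_mul, hAs.eq, hM.eq]
  have hMCM : A * M * C * (M * A) = A * M * A := by
    rw [mul_assoc A M C, hMC, mul_one, mul_assoc]
  have hl : A * M * A = t • (A₁ * (M * A)) + (1 - t) • (A₂ * (M * A)) := by
    rw [mul_assoc, ← smul_mul_assoc, ← smul_mul_assoc, ← add_mul]
  have hr : A * M * A = t • (A * M * A₁) + (1 - t) • (A * M * A₂) := by
    rw [← mul_smul_comm, ← mul_smul_comm, ← mul_add]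
  rw [hX]
  simp only [mul_sub, sub_mul, mul_add, add_mul, mul_smul_comm, smul_mul_assoc, smul_sub,
    smul_add, hMCM]
  linear_combination (norm := module) -hl - hr
end

section
/- Let p, q be nonzero real numbers and fix n ≥ 2. The map (A,B) ↦ A^{q/2} B^p A^{q/2} from pairs of n×n positive definite complex matrices to matrices is never jointly operator concave: there exist positive definite A₁,A₂,B₁,B₂ and λ ∈ [0,1] for which the concavity inequality in the Loewner order fails. -/
open Matrix
open scoped ComplexOrder

/-- Joint operator concavity (in the Loewner order) of a matrix-valued function of two
positive definite matrices. -/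
def JointlyOpConcave {n : ℕ}
    (F : Matrix (Fin n) (Fin n) ℂ → Matrix (Fin n) (Fin n) ℂ → Matrix (Fin n) (Fin n) ℂ) :
    Prop :=
  ∀ A₁ A₂ B₁ B₂ : Matrix (Fin n) (Fin n) ℂ,
    A₁.PosDef → A₂.PosDef → B₁.PosDef → B₂.PosDef →
    ∀ t : ℝ, 0 ≤ t → t ≤ 1 →
      (F (t • A₁ + (1 - t) • A₂) (t • B₁ + (1 - t) • B₂) -
        (t • F A₁ B₁ + (1 - t) • F A₂ B₂)).PosSemidef

/-- Real powers respect intertwining with a real diagonal matrix. -/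
lemma mpow_mul_of_mul_diagonal {n : ℕ} {A V : Matrix (Fin n) (Fin n) ℂ} (hA : A.IsHermitian)
    {d : Fin n → ℝ} (h : A * V = V * diagonal (fun i => (d i : ℂ))) (r : ℝ) :
    mpow A r * V = V * diagonal (fun i => ((d i ^ r : ℝ) : ℂ)) := by
  set U := (hA.eigenvectorUnitary : Matrix (Fin n) (Fin n) ℂ)
  have hUU : star U * U = 1 := Unitary.coe_star_mul_self hA.eigenvectorUnitary
  have hUU' : U * star U = 1 := Unitary.coe_mul_star_self hA.eigenvectorUnitary
  have hspec : A = U * diagonal (fun i => (hA.eigenvalues i : ℂ)) * star U := by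
    conv_lhs => rw [hA.spectral_theorem, Unitary.conjStarAlgAut_apply]
    rfl
  have hW : diagonal (fun i => (hA.eigenvalues i : ℂ)) * (star U * V)
      = (star U * V) * diagonal (fun i => (d i : ℂ)) := by
    calc _ = (star U * U) * diagonal (fun i => (hA.eigenvalues i : ℂ)) * (star U * V) := by
          rw [hUU, one_mul]
      _ = star U * ((U * diagonal (fun i => (hA.eigenvalues i : ℂ)) * star U) * V) := by
          simp only [mul_assoc]
      _ = _ := by rw [← hspec, h, mul_assoc]
  have hWr : diagonal (fun i => ((hA.eigenvalues i ^ r : ℝ) : ℂ)) * (star U * V)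
      = (star U * V) * diagonal (fun i => ((d i ^ r : ℝ) : ℂ)) := by
    ext i j
    have hij := congrFun (congrFun hW i) j
    rw [diagonal_mul, mul_diagonal, mul_comm] at hij
    rw [diagonal_mul, mul_diagonal, mul_comm]
    by_cases h0 : (star U * V) i j = 0
    · simp [h0]
    · have heq : hA.eigenvalues i = d j := by exact_mod_cast mul_left_cancel₀ h0 hij
      rw [heq]
  have hm : mpow A r = U * diagonal (fun i => ((hA.eigenvalues i ^ r : ℝ) : ℂ)) * star U := by
    rw [mpow, dif_pos hA]
  rw [hm, mul_assoc, mul_assoc, hWr, ← mul_assoc, ← mul_assoc, hUU', one_mul]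

lemma mpow_diagonal {n : ℕ} (d : Fin n → ℝ) (r : ℝ) :
    mpow (diagonal (fun i => (d i : ℂ))) r = diagonal (fun i => ((d i ^ r : ℝ) : ℂ)) := by
  have hA : (diagonal (fun i => (d i : ℂ))).IsHermitian :=
    isHermitian_diagonal_iff.2 fun i => by simp [isSelfAdjoint_iff]
  simpa using mpow_mul_of_mul_diagonal hA (V := 1) (d := d) (by simp) r

lemma exists_posDef_mpow_eq {n : ℕ} {C : Matrix (Fin n) (Fin n) ℂ} (hC : C.PosDef) {p : ℝ}
    (hp : p ≠ 0) : ∃ B : Matrix (Fin n) (Fin n) ℂ, B.PosDef ∧ mpow B p = C := by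
  set hH := hC.isHermitian
  set U := (hH.eigenvectorUnitary : Matrix (Fin n) (Fin n) ℂ)
  have hUU : star U * U = 1 := Unitary.coe_star_mul_self hH.eigenvectorUnitary
  have hUU' : U * star U = 1 := Unitary.coe_mul_star_self hH.eigenvectorUnitary
  have hspec : C = U * diagonal (fun i => (hH.eigenvalues i : ℂ)) * star U := by
    conv_lhs => rw [hH.spectral_theorem, Unitary.conjStarAlgAut_apply]
    rfl
  let B := U * diagonal (fun i => ((hH.eigenvalues i ^ p⁻¹ : ℝ) : ℂ)) * star U
  have hB : B.PosDef := by
    refine (Matrix.IsUnit.posDef_star_right_conjugate_iff Unitary.isUnit_coe).2 ?_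
    refine posDef_diagonal_iff.2 fun i => ?_
    exact_mod_cast Real.rpow_pos_of_pos (hC.eigenvalues_pos i) _
  refine ⟨B, hB, ?_⟩
  have h := mpow_mul_of_mul_diagonal hB.isHermitian (V := U)
    (d := fun i => hH.eigenvalues i ^ p⁻¹) (by simp only [B, mul_assoc, hUU, mul_one]) p
  have hpow : ∀ i, (hH.eigenvalues i ^ p⁻¹) ^ p = hH.eigenvalues i := fun i =>
    Real.rpow_inv_rpow (hC.eigenvalues_pos i).le hp
  simp only [hpow] at h
  rw [hspec, ← h, mul_assoc, hUU', mul_one]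

lemma Matrix.PosSemidef.re_quadratic_pair_nonneg {n : ℕ} {M : Matrix (Fin n) (Fin n) ℂ}
    (hM : M.PosSemidef) (i j : Fin n) (c : ℝ) :
    0 ≤ (M i i).re + c * ((M i j).re + (M j i).re) + c ^ 2 * (M j j).re := by
  have h := hM.dotProduct_mulVec_nonneg (Pi.single i 1 + Pi.single j (c : ℂ))
  have h' := (Complex.le_def.1 h).1
  simp [mulVec_add, add_dotProduct] at h'
  linarith

lemma posDef_one_add_smul_one {n : ℕ} {δ : ℝ} (hδ : 0 < δ) :
    (Matrix.of (fun _ _ => 1) + (δ : ℂ) • 1 : Matrix (Fin n) (Fin n) ℂ).PosDef := by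
  refine PosDef.posSemidef_add ?_ (PosDef.one.smul (by exact_mod_cast hδ))
  convert posSemidef_vecMulVec_self_star (fun _ : Fin n => (1 : ℂ)) using 1
  ext i j
  simp [vecMulVec_apply]

lemma posDef_diagonal_update {n : ℕ} (i : Fin n) {a : ℝ} (ha : 0 < a) :
    (diagonal (fun k => ((Function.update (1 : Fin n → ℝ) i a k : ℝ) : ℂ))).PosDef := by
  refine posDef_diagonal_iff.2 fun k => ?_
  obtain rfl | hk := eq_or_ne k i
  · simpa using ha
  · simp [hk]

/-- Theorem 3.2 (2): `(A,B) ↦ A^{q/2} B^p A^{q/2}` is never jointly operator concave. -/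
theorem not_operator_concave (p q : ℝ) (hp : p ≠ 0) (hq : q ≠ 0) (n : ℕ) (hn : 2 ≤ n) :
    ¬ JointlyOpConcave (fun A B : Matrix (Fin n) (Fin n) ℂ =>
        mpow A (q / 2) * mpow B p * mpow A (q / 2)) := by
  intro h
  let i : Fin n := ⟨0, by omega⟩
  let j : Fin n := ⟨1, by omega⟩
  have hji : j ≠ i := by simp [i, j]
  let m : ℝ := 2 ^ (q / 2)
  have hm : 0 < m := Real.rpow_pos_of_pos two_pos _
  have hm1 : m ≠ 1 := by
    intro h1
    have hlog := congrArg Real.log h1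
    rw [Real.log_rpow two_pos, Real.log_one] at hlog
    norm_num [hq] at hlog
  have hm2 : 0 < (1 - m) ^ 2 := by
    have : 1 - m ≠ 0 := sub_ne_zero.2 hm1.symm
    positivity
  let δ : ℝ := (1 - m) ^ 2 / (8 * m ^ 2)
  have hδ : 0 < δ := by positivity
  obtain ⟨B, hB, hBp⟩ := exists_posDef_mpow_eq (posDef_one_add_smul_one (n := n) hδ) hp
  let D : ℝ → Matrix (Fin n) (Fin n) ℂ := fun a =>
    diagonal (fun k => ((Function.update (1 : Fin n → ℝ) i a k : ℝ) : ℂ))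
  have hDpow : ∀ a, mpow (D a) (q / 2) = D (a ^ (q / 2)) := by
    intro a
    rw [mpow_diagonal]
    congr 1
    ext k
    obtain rfl | hk := eq_or_ne k i
    · simp
    · simp [hk]
  have hmid : (1 / 2 : ℝ) • D 1 + (1 - 1 / 2 : ℝ) • D 3 = D 2 := by
    simp only [D, ← diagonal_smul, diagonal_add]
    congr 1
    ext k
    obtain rfl | hk := eq_or_ne k i
    · simp
      norm_num
    · simp [hk]
  have hmidB : (1 / 2 : ℝ) • B + (1 - 1 / 2 : ℝ) • B = B := by
    rw [← add_smul]; norm_num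
  have key := h (D 1) (D 3) B B (posDef_diagonal_update i one_pos)
    (posDef_diagonal_update i three_pos) hB hB (1 / 2) (by norm_num) (by norm_num)
  simp only [hmid, hmidB, hDpow, hBp, Real.one_rpow] at key
  have hquad := key.re_quadratic_pair_nonneg i j (-m)
  simp [D, hji, hji.symm, mul_diagonal, diagonal_mul] at hquad
  have hδm : δ * m ^ 2 = (1 - m) ^ 2 / 8 := by
    simp only [δ]
    field_simp
  rw [show (2 : ℝ) ^ (q / 2) = m from rfl] at hquad
  generalize (3 : ℝ) ^ (q / 2) = x at hquad
  clear_value δ m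
  have hpos : 0 ≤ (x - m) ^ 2 + δ * (1 + m ^ 2) + δ * (x ^ 2 + m ^ 2) := by positivity
  linarith
end
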